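/- arXiv:1312.4468 — 2 statements merged into one kernel-verified Lean document; each statement's English description precedes it below -/
import Mathlib

section
/- (Theorem 1, Part 2.) Let W be a B-DMC with finite output alphabet, ε ∈ [0, 1], x ∈ [0, 1/2], and fix ρ₁ ∈ (−1, 0). If E0(ρ₁, BSC_x) ≤ E0(ρ₁, W) ≤ E0(ρ₁, BEC_ε), then for every ρ₂ ∈ (−1, ρ₁] one has both R(ρ₂, BEC_ε) ≤ R(ρ₂, W) ≤ R(ρ₂, BSC_x) and E0(ρ₂, BSC_x) ≤ E0(ρ₂, W) ≤ E0(ρ₂, BEC_ε). -/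
/-- A binary-input discrete memoryless channel: a nonempty finite output alphabet `Y`
together with conditional probability mass functions `W0 = W(·|0)` and `W1 = W(·|1)`. -/
structure BDMC where
  Y : Type
  [fin : Fintype Y]
  [ne : Nonempty Y]
  W0 : Y → ℝ
  W1 : Y → ℝ
  W0_nonneg : ∀ y, 0 ≤ W0 y
  W1_nonneg : ∀ y, 0 ≤ W1 y
  sum_W0 : ∑ y, W0 y = 1
  sum_W1 : ∑ y, W1 y = 1

attribute [instance] BDMC.fin BDMC.ne

/-- Gallager's `E₀` function of a B-DMC under the uniform input distribution:
`E₀(ρ, W) = −log ∑_y (½ W(y|0)^{1/(1+ρ)} + ½ W(y|1)^{1/(1+ρ)})^{1+ρ}`. -/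
noncomputable def E0 (ρ : ℝ) (W : BDMC) : ℝ :=
  -Real.log (∑ y, ((1/2) * W.W0 y ^ (1/(1+ρ)) + (1/2) * W.W1 y ^ (1/(1+ρ))) ^ (1+ρ))

/-- `E₀` of the binary erasure channel with erasure probability `ε`:
`E₀(ρ, BEC_ε) = −log(2^{−ρ}(1−ε) + ε)`. -/
noncomputable def E0bec (ρ ε : ℝ) : ℝ := -Real.log ((2:ℝ) ^ (-ρ) * (1-ε) + ε)

/-- `E₀` of the binary symmetric channel with crossover probability `x`:
`E₀(ρ, BSC_x) = −log(2^{−ρ}(x^{1/(1+ρ)} + (1−x)^{1/(1+ρ)})^{1+ρ})`. -/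
noncomputable def E0bsc (ρ x : ℝ) : ℝ :=
  -Real.log ((2:ℝ) ^ (-ρ) * (x ^ (1/(1+ρ)) + (1-x) ^ (1/(1+ρ))) ^ (1+ρ))

/-- `R(ρ, W)`: the derivative of `ρ ↦ E₀(ρ, W)` at `ρ`. -/
noncomputable def RW (ρ : ℝ) (W : BDMC) : ℝ := deriv (fun r => E0 r W) ρ

/-- `R(ρ, BEC_ε)`: the derivative of `ρ ↦ E₀(ρ, BEC_ε)` at `ρ`. -/
noncomputable def Rbec (ρ ε : ℝ) : ℝ := deriv (fun r => E0bec r ε) ρ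

/-- `R(ρ, BSC_x)`: the derivative of `ρ ↦ E₀(ρ, BSC_x)` at `ρ`. -/
noncomputable def Rbsc (ρ x : ℝ) : ℝ := deriv (fun r => E0bsc r x) ρ

open Real Set Filter Topology

/-- The power mean of two numbers with exponent `1 / s`, as it occurs in Gallager's function. -/
noncomputable def gallagerMean (s a b : ℝ) : ℝ :=
  ((1/2) * a ^ (1/s) + (1/2) * b ^ (1/s)) ^ s

/-- The ratio `cosh (p u) ^ (1 / p) / cosh u`: the power mean of `exp u` and `exp (-u)` with
exponent `p`, normalized by the arithmetic mean. -/
noncomputable def coshRatio (p u : ℝ) : ℝ := exp (log (cosh (p * u)) / p - log (cosh u))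

/-- The derivative of `coshRatio p`. -/
noncomputable def coshRatioDeriv (p u : ℝ) : ℝ :=
  coshRatio p u * (tanh (p * u) - tanh u)

theorem hasDerivAt_log_cosh_mul (p u : ℝ) :
    HasDerivAt (fun v => log (cosh (p * v))) (p * tanh (p * u)) u := by
  have h : HasDerivAt (fun v => p * v) p u := by simpa using (hasDerivAt_id u).const_mul p
  convert h.cosh.log (cosh_pos _).ne' using 1
  rw [tanh_eq_sinh_div_cosh]
  ring

theorem coshRatio_pos (p u : ℝ) : 0 < coshRatio p u := exp_pos _

theorem hasDerivAt_coshRatio {p : ℝ} (hp : p ≠ 0) (u : ℝ) :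
    HasDerivAt (coshRatio p) (coshRatioDeriv p u) u := by
  have h1 : HasDerivAt (fun v => log (cosh v)) (tanh u) u := by
    simpa using hasDerivAt_log_cosh_mul 1 u
  have h := (((hasDerivAt_log_cosh_mul p u).div_const p).sub h1).exp
  rw [mul_div_cancel_left₀ _ hp] at h
  exact h

theorem tanh_sub_tanh (x y : ℝ) : tanh x - tanh y = sinh (x - y) / (cosh x * cosh y) := by
  have := (cosh_pos x).ne'
  have := (cosh_pos y).ne'
  rw [tanh_eq_sinh_div_cosh, tanh_eq_sinh_div_cosh, sinh_sub]
  field_simp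

theorem coshRatioDeriv_pos {p u : ℝ} (hp : 1 < p) (hu : 0 < u) : 0 < coshRatioDeriv p u := by
  refine mul_pos (coshRatio_pos _ _) ?_
  rw [tanh_sub_tanh]
  have : 0 < sinh (p * u - u) := sinh_pos_iff.2 (by nlinarith)
  have := cosh_pos (p * u)
  have := cosh_pos u
  positivity

theorem mul_sinh_mul_le_mul_sinh_mul {a b u : ℝ} (ha : 0 ≤ a) (hab : a ≤ b) (hu : 0 ≤ u) :
    b * sinh (a * u) ≤ a * sinh (b * u) := by
  have hd (v : ℝ) : HasDerivAt (fun v => a * sinh (b * v) - b * sinh (a * v))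
      (a * (cosh (b * v) * b) - b * (cosh (a * v) * a)) v := by
    have h (c : ℝ) : HasDerivAt (fun v => c * v) c v := by
      simpa using (hasDerivAt_id v).const_mul c
    exact ((h b).sinh.const_mul a).sub ((h a).sinh.const_mul b)
  have hm : MonotoneOn (fun v => a * sinh (b * v) - b * sinh (a * v)) (Ici 0) := by
    refine monotoneOn_of_deriv_nonneg (convex_Ici 0)
      (fun v _ => (hd v).continuousAt.continuousWithinAt)
      (fun v _ => (hd v).differentiableAt.differentiableWithinAt) fun v hv => ?_
    rw [interior_Ici, mem_Ioi] at hv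
    rw [(hd v).deriv]
    have h : cosh (a * v) ≤ cosh (b * v) := by
      rw [cosh_le_cosh, abs_of_nonneg (by positivity), abs_of_nonneg (by nlinarith)]
      gcongr
    nlinarith [mul_nonneg ha (ha.trans hab)]
  have h := hm (mem_Ici.2 le_rfl) hu hu
  simp only [mul_zero, sinh_zero, sub_zero] at h
  linarith

/-- Up to a term independent of `p`, the logarithm of `coshRatioDeriv p` on `(0, ∞)`. -/
noncomputable def logCoshRatioDeriv (p u : ℝ) : ℝ :=
  (1 / p - 1) * log (cosh (p * u)) + log (sinh ((p - 1) * u))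

theorem coshRatioDeriv_eq_exp {p u : ℝ} (hp : 1 < p) (hu : 0 < u) :
    coshRatioDeriv p u = exp (logCoshRatioDeriv p u) * exp (-2 * log (cosh u)) := by
  have hs : 0 < sinh ((p - 1) * u) := sinh_pos_iff.2 (mul_pos (by linarith) hu)
  have hc := cosh_pos (p * u)
  have hc' := cosh_pos u
  have h : tanh (p * u) - tanh u
      = exp (log (sinh ((p - 1) * u)) - log (cosh (p * u)) - log (cosh u)) := by
    rw [tanh_sub_tanh, exp_sub, exp_sub, exp_log hs, exp_log hc, exp_log hc', div_div]
    congr 2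
    ring
  rw [coshRatioDeriv, h, coshRatio, logCoshRatioDeriv, ← exp_add, ← exp_add]
  congr 1
  ring

theorem hasDerivAt_logCoshRatioDeriv {p u : ℝ} (hp : 1 < p) (hu : 0 < u) :
    HasDerivAt (logCoshRatioDeriv p)
      ((p - 1) * cosh u / (sinh ((p - 1) * u) * cosh (p * u))) u := by
  have hs : 0 < sinh ((p - 1) * u) := sinh_pos_iff.2 (mul_pos (by linarith) hu)
  have hc := cosh_pos (p * u)
  have h : HasDerivAt (fun v => (p - 1) * v) (p - 1) u := by
    simpa using (hasDerivAt_id u).const_mul (p - 1)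
  refine (((hasDerivAt_log_cosh_mul p u).const_mul (1 / p - 1)).add
    (h.sinh.log hs.ne')).congr_deriv ?_
  have hcu : cosh u = cosh (p * u) * cosh ((p - 1) * u) - sinh (p * u) * sinh ((p - 1) * u) := by
    rw [← cosh_sub]
    congr 1
    ring
  have hp0 : p ≠ 0 := by linarith
  have hs0 := hs.ne'
  rw [hcu, tanh_eq_sinh_div_cosh]
  generalize sinh ((p - 1) * u) = S at *
  field_simp
  ring

theorem antitoneOn_logCoshRatioDeriv_sub {p p' : ℝ} (hp : 1 < p) (hpp' : p ≤ p') :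
    AntitoneOn (fun u => logCoshRatioDeriv p' u - logCoshRatioDeriv p u) (Ioi 0) := by
  have hd {u : ℝ} (hu : 0 < u) :=
    (hasDerivAt_logCoshRatioDeriv (hp.trans_le hpp') hu).sub (hasDerivAt_logCoshRatioDeriv hp hu)
  refine antitoneOn_of_deriv_nonpos (convex_Ioi 0)
    (fun u hu => (hd hu).continuousAt.continuousWithinAt)
    (fun u hu => (hd (interior_subset hu)).differentiableAt.differentiableWithinAt) fun u hu => ?_
  have hu : 0 < u := interior_subset hu
  refine (hd hu).deriv.trans_le (sub_nonpos.2 ?_)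
  have hs : 0 < sinh ((p - 1) * u) := sinh_pos_iff.2 (mul_pos (by linarith) hu)
  have hs' : 0 < sinh ((p' - 1) * u) := sinh_pos_iff.2 (mul_pos (by linarith) hu)
  have hc := cosh_pos (p * u)
  have hc' := cosh_pos (p' * u)
  have h1 : (p' - 1) * sinh ((p - 1) * u) ≤ (p - 1) * sinh ((p' - 1) * u) :=
    mul_sinh_mul_le_mul_sinh_mul (by linarith) (by linarith) hu.le
  have h2 : cosh (p * u) ≤ cosh (p' * u) := by
    rw [cosh_le_cosh, abs_of_nonneg (by nlinarith), abs_of_nonneg (by nlinarith)]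
    gcongr
  rw [div_le_div_iff₀ (by positivity) (by positivity)]
  calc (p' - 1) * cosh u * (sinh ((p - 1) * u) * cosh (p * u))
      = cosh u * (((p' - 1) * sinh ((p - 1) * u)) * cosh (p * u)) := by ring
    _ ≤ cosh u * (((p - 1) * sinh ((p' - 1) * u)) * cosh (p' * u)) := by
        have := (cosh_pos u).le
        have : 0 ≤ (p - 1) * sinh ((p' - 1) * u) := mul_nonneg (by linarith) hs'.le
        gcongr
    _ = _ := by ring

theorem antitoneOn_coshRatioDeriv_div {p p' : ℝ} (hp : 1 < p) (hpp' : p ≤ p') :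
    AntitoneOn (fun u => coshRatioDeriv p' u / coshRatioDeriv p u) (Ioi 0) := by
  have h {u : ℝ} (hu : 0 < u) : coshRatioDeriv p' u / coshRatioDeriv p u
      = exp (logCoshRatioDeriv p' u - logCoshRatioDeriv p u) := by
    rw [coshRatioDeriv_eq_exp (hp.trans_le hpp') hu, coshRatioDeriv_eq_exp hp hu, exp_sub,
      mul_div_mul_right _ _ (exp_pos _).ne']
  intro u hu v hv huv
  simp only [h hu, h hv]
  exact exp_le_exp.2 (antitoneOn_logCoshRatioDeriv_sub hp hpp' hu hv huv)

theorem monotoneOn_coshRatio_sub {p p' c v : ℝ} (hp : 1 < p) (hpp' : p ≤ p') (hv : 0 < v)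
    (hc : c ≤ coshRatioDeriv p' v / coshRatioDeriv p v) :
    MonotoneOn (fun u => coshRatio p' u - c * coshRatio p u) (Icc 0 v) := by
  have hd (u : ℝ) := (hasDerivAt_coshRatio (p := p') (by linarith) u).sub
    ((hasDerivAt_coshRatio (p := p) (by linarith) u).const_mul c)
  refine monotoneOn_of_deriv_nonneg (convex_Icc 0 v)
    (fun u _ => (hd u).continuousAt.continuousWithinAt)
    (fun u _ => (hd u).differentiableAt.differentiableWithinAt) fun u hu => ?_
  rw [interior_Icc] at hu
  refine (sub_nonneg.2 ?_).trans_eq (hd u).deriv.symm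
  rw [← le_div_iff₀ (coshRatioDeriv_pos hp hu.1)]
  exact hc.trans (antitoneOn_coshRatioDeriv_div hp hpp' hu.1 hv hu.2.le)

theorem antitoneOn_coshRatio_sub {p p' c v : ℝ} (hp : 1 < p) (hpp' : p ≤ p') (hv : 0 < v)
    (hc : coshRatioDeriv p' v / coshRatioDeriv p v ≤ c) :
    AntitoneOn (fun u => coshRatio p' u - c * coshRatio p u) (Ici v) := by
  have hd (u : ℝ) := (hasDerivAt_coshRatio (p := p') (by linarith) u).sub
    ((hasDerivAt_coshRatio (p := p) (by linarith) u).const_mul c)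
  refine antitoneOn_of_deriv_nonpos (convex_Ici v)
    (fun u _ => (hd u).continuousAt.continuousWithinAt)
    (fun u _ => (hd u).differentiableAt.differentiableWithinAt) fun u hu => ?_
  rw [interior_Ici] at hu
  have hu0 : 0 < u := hv.trans hu
  refine (hd u).deriv.trans_le (sub_nonpos.2 ?_)
  rw [← div_le_iff₀ (coshRatioDeriv_pos hp hu0)]
  exact (antitoneOn_coshRatioDeriv_div hp hpp' hv hu0 (le_of_lt hu)).trans hc

theorem coshRatio_div_le_coshRatioDeriv_div {p p' v : ℝ} (hp : 1 < p) (hpp' : p ≤ p')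
    (hv : 0 < v) :
    coshRatio p' v / coshRatio p v ≤ coshRatioDeriv p' v / coshRatioDeriv p v := by
  rw [div_le_div_iff₀ (coshRatio_pos _ _) (coshRatioDeriv_pos hp hv)]
  have h : 0 ≤ tanh (p' * v) - tanh (p * v) := by
    rw [tanh_sub_tanh]
    exact div_nonneg (sinh_nonneg_iff.2 (by nlinarith))
      (mul_pos (cosh_pos _) (cosh_pos _)).le
  have h' := mul_nonneg (mul_pos (coshRatio_pos p' v) (coshRatio_pos p v)).le h
  rw [coshRatioDeriv, coshRatioDeriv]
  linarith

theorem coshRatio_zero (p : ℝ) : coshRatio p 0 = 1 := by simp [coshRatio]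

theorem gallagerMean_eq_mul_coshRatio {s a b : ℝ} (hs : 0 < s) (ha : 0 < a) (hb : 0 < b) :
    gallagerMean s a b = (a + b) / 2 * coshRatio (1 / s) (log (a / b) / 2) := by
  have key (p : ℝ) : (1 / 2) * a ^ p + (1 / 2) * b ^ p
      = exp (p * ((log a + log b) / 2)) * cosh (p * (log (a / b) / 2)) := by
    rw [log_div ha.ne' hb.ne', cosh_eq, rpow_def_of_pos ha, rpow_def_of_pos hb, mul_div_assoc',
      mul_add, ← exp_add, ← exp_add]
    ring_nf
  have h1 := key 1
  have hq : (a + b) / 2 = exp ((log a + log b) / 2) * cosh (log (a / b) / 2) := by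
    rw [rpow_one, rpow_one, one_mul, one_mul] at h1
    rw [← h1]
    ring
  rw [gallagerMean, key, hq, coshRatio, exp_sub, exp_log (cosh_pos _),
    mul_rpow (exp_pos _).le (cosh_pos _).le, ← exp_mul, rpow_def_of_pos (cosh_pos _)]
  have := (cosh_pos (log (a / b) / 2)).ne'
  field_simp

theorem continuous_gallagerMean_comp {s a b : ℝ} (hs : 0 < s) :
    Continuous fun t => gallagerMean s (a + t) (b + t) := by
  have : (0:ℝ) ≤ 1 / s := by positivity
  unfold gallagerMean
  refine Continuous.rpow_const ?_ fun _ => Or.inr hs.le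
  have h (c : ℝ) : Continuous fun t : ℝ => (c + t) ^ (1 / s) :=
    (by fun_prop : Continuous fun t : ℝ => c + t).rpow_const fun _ => Or.inr this
  exact ((h a).const_mul _).add ((h b).const_mul _)

theorem gallagerMean_comm (s a b : ℝ) : gallagerMean s a b = gallagerMean s b a := by
  rw [gallagerMean, gallagerMean, add_comm]

theorem gallagerMean_linear_nonneg {s t α β γ : ℝ} (hs : 0 < s) (ht : 0 < t)
    (h : ∀ u, 0 ≤ u → 0 ≤ α * coshRatio (1 / s) u + β * coshRatio (1 / t) u + γ)
    {a b : ℝ} (ha : 0 ≤ a) (hb : 0 ≤ b) :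
    0 ≤ α * gallagerMean s a b + β * gallagerMean t a b + γ * ((a + b) / 2) := by
  wlog hab : b ≤ a generalizing a b
  · rw [gallagerMean_comm s, gallagerMean_comm t, add_comm a]
    exact this hb ha (le_of_not_ge hab)
  have hlim : Tendsto (fun r => α * gallagerMean s (a + r) (b + r)
      + β * gallagerMean t (a + r) (b + r) + γ * ((a + r + (b + r)) / 2)) (𝓝[>] 0)
      (𝓝 (α * gallagerMean s a b + β * gallagerMean t a b + γ * ((a + b) / 2))) := by
    have hc : Continuous fun r => α * gallagerMean s (a + r) (b + r)
      + β * gallagerMean t (a + r) (b + r) + γ * ((a + r + (b + r)) / 2) :=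
      (((continuous_gallagerMean_comp hs).const_mul α).add
        ((continuous_gallagerMean_comp ht).const_mul β)).add (by fun_prop)
    simpa using (hc.tendsto 0).mono_left nhdsWithin_le_nhds
  refine ge_of_tendsto hlim ?_
  filter_upwards [self_mem_nhdsWithin] with r hr
  have hr : 0 < r := hr
  have ha' : 0 < a + r := by linarith
  have hb' : 0 < b + r := by linarith
  rw [gallagerMean_eq_mul_coshRatio hs ha' hb', gallagerMean_eq_mul_coshRatio ht ha' hb']
  have hu : 0 ≤ log ((a + r) / (b + r)) / 2 := by
    have : 1 ≤ (a + r) / (b + r) := by rw [one_le_div hb']; linarith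
    have := log_nonneg this
    positivity
  have := mul_nonneg (by linarith : 0 ≤ (a + r + (b + r)) / 2) (h _ hu)
  linarith

theorem tendsto_coshRatio_atTop {s : ℝ} (hs : 0 < s) :
    Tendsto (coshRatio (1 / s)) atTop (𝓝 (2 ^ (1 - s))) := by
  have h1 : Tendsto (fun u : ℝ => exp (-2 * u)) atTop (𝓝 0) :=
    tendsto_exp_atBot.comp (tendsto_id.const_mul_atTop_of_neg (by norm_num))
  have h0 : (0:ℝ) ≤ 1 / s := by positivity
  have hc : Continuous fun r : ℝ => gallagerMean s 1 r := by
    unfold gallagerMean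
    refine Continuous.rpow_const ?_ fun _ => Or.inr hs.le
    exact continuous_const.add ((continuous_id.rpow_const fun _ => Or.inr h0).const_mul _)
  have hq : Continuous fun r : ℝ => (1 + r) / 2 := by fun_prop
  have h2 := ((hc.tendsto 0).comp h1).div ((hq.tendsto 0).comp h1) (by norm_num)
  have hv : gallagerMean s 1 0 / ((1 + 0) / 2) = 2 ^ (1 - s) := by
    have : 1 / s ≠ 0 := by positivity
    rw [gallagerMean, one_rpow, zero_rpow this, rpow_sub two_pos, rpow_one, mul_one, mul_zero,
      add_zero, add_zero, div_rpow one_pos.le two_pos.le, one_rpow]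
    field_simp
  rw [hv] at h2
  refine h2.congr fun u => ?_
  have he := exp_pos (-2 * u)
  simp only [Function.comp_apply, Pi.div_apply]
  rw [gallagerMean_eq_mul_coshRatio hs one_pos he, mul_div_cancel_left₀ _ (by positivity), one_div (exp _),
    ← exp_neg, log_exp]
  congr 1
  ring

theorem coshRatio_chord {s t u : ℝ} (hs : 0 < s) (hst : s < t) (ht : t < 1) (hu : 0 ≤ u) :
    (coshRatio (1 / t) u - 1) * (2 ^ (1 - s) - 1)
      ≤ (coshRatio (1 / s) u - 1) * (2 ^ (1 - t) - 1) := by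
  have hp : 1 < 1 / t := (one_lt_div (hs.trans hst)).2 ht
  have hpp : 1 / t ≤ 1 / s := one_div_le_one_div_of_le hs hst.le
  have hK : 0 < (2:ℝ) ^ (1 - t) - 1 := sub_pos.2 (one_lt_rpow one_lt_two (by linarith))
  set k := ((2:ℝ) ^ (1 - s) - 1) / (2 ^ (1 - t) - 1) with hk
  have hk' : (2:ℝ) ^ (1 - s) - 1 = k * (2 ^ (1 - t) - 1) := by rw [hk]; field_simp
  suffices 1 - k ≤ coshRatio (1 / s) u - k * coshRatio (1 / t) u by
    rw [hk']
    nlinarith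
  rcases hu.eq_or_lt with rfl | hu
  · simp [coshRatio_zero]
  rcases le_total k (coshRatioDeriv (1 / s) u / coshRatioDeriv (1 / t) u) with h | h
  · have := monotoneOn_coshRatio_sub hp hpp hu h (left_mem_Icc.2 hu.le) (right_mem_Icc.2 hu.le)
      hu.le
    simpa [coshRatio_zero] using this
  · have hlim := (tendsto_coshRatio_atTop hs).sub
      ((tendsto_coshRatio_atTop (hs.trans hst)).const_mul k)
    have heq : (2:ℝ) ^ (1 - s) - k * 2 ^ (1 - t) = 1 - k := by linarith
    rw [heq] at hlim
    refine le_of_tendsto hlim ?_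
    filter_upwards [eventually_ge_atTop u] with v hv
    exact antitoneOn_coshRatio_sub hp hpp hu h (mem_Ici.2 le_rfl) hv hv

theorem gallagerMean_chord {s t a b : ℝ} (hs : 0 < s) (hst : s < t) (ht : t < 1)
    (ha : 0 ≤ a) (hb : 0 ≤ b) :
    (gallagerMean t a b - (a + b) / 2) * (2 ^ (1 - s) - 1)
      ≤ (gallagerMean s a b - (a + b) / 2) * (2 ^ (1 - t) - 1) := by
  have := gallagerMean_linear_nonneg (α := 2 ^ (1 - t) - 1) (β := -(2 ^ (1 - s) - 1))
    (γ := 2 ^ (1 - s) - 2 ^ (1 - t)) hs (hs.trans hst)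
    (fun u hu => by linarith [coshRatio_chord hs hst ht hu]) ha hb
  linarith

theorem coshRatio_tangent {p p' u v : ℝ} (hp : 1 < p) (hpp' : p ≤ p') (hu : 0 ≤ u) (hv : 0 < v) :
    coshRatio p' u - coshRatioDeriv p' v / coshRatioDeriv p v * coshRatio p u
      ≤ coshRatio p' v - coshRatioDeriv p' v / coshRatioDeriv p v * coshRatio p v := by
  rcases le_total u v with h | h
  · exact monotoneOn_coshRatio_sub hp hpp' hv le_rfl ⟨hu, h⟩ (right_mem_Icc.2 hv.le) h
  · exact antitoneOn_coshRatio_sub hp hpp' hv le_rfl (mem_Ici.2 le_rfl) h h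

theorem exists_gallagerMean_tangent {s t x : ℝ} (hs : 0 < s) (hst : s < t) (ht : t < 1)
    (hx : 0 < x) (hx' : x < 1 / 2) :
    ∃ c, gallagerMean s (2 * (1 - x)) (2 * x) ≤ c * gallagerMean t (2 * (1 - x)) (2 * x) ∧
      ∀ a b, 0 ≤ a → 0 ≤ b →
        gallagerMean s a b - (a + b) / 2 * gallagerMean s (2 * (1 - x)) (2 * x)
          ≤ c * (gallagerMean t a b - (a + b) / 2 * gallagerMean t (2 * (1 - x)) (2 * x)) := by
  have ht0 := hs.trans hst
  have hp : 1 < 1 / t := (one_lt_div ht0).2 ht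
  have hpp : 1 / t ≤ 1 / s := one_div_le_one_div_of_le hs hst.le
  have hx1 : 0 < 2 * (1 - x) := by linarith
  have hx2 : 0 < 2 * x := by linarith
  set v := log (2 * (1 - x) / (2 * x)) / 2 with hv
  have hv0 : 0 < v := half_pos (log_pos ((one_lt_div hx2).2 (by linarith)))
  have hγ {r : ℝ} (hr : 0 < r) :
      gallagerMean r (2 * (1 - x)) (2 * x) = coshRatio (1 / r) v := by
    rw [gallagerMean_eq_mul_coshRatio hr hx1 hx2, ← hv,
      show (2 * (1 - x) + 2 * x) / 2 = 1 by ring, one_mul]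
  set c := coshRatioDeriv (1 / s) v / coshRatioDeriv (1 / t) v with hc
  refine ⟨c, ?_, fun a b ha hb => ?_⟩
  · rw [hγ hs, hγ ht0, ← div_le_iff₀ (coshRatio_pos _ _)]
    exact coshRatio_div_le_coshRatioDeriv_div hp hpp hv0
  · have := gallagerMean_linear_nonneg (α := -1) (β := c)
      (γ := coshRatio (1 / s) v - c * coshRatio (1 / t) v) hs ht0
      (fun u hu => by linarith [coshRatio_tangent hp hpp hu hv0]) ha hb
    rw [hγ hs, hγ ht0]
    linarith

theorem gallagerMean_nonneg {s a b : ℝ} (ha : 0 ≤ a) (hb : 0 ≤ b) : 0 ≤ gallagerMean s a b := by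
  unfold gallagerMean
  positivity

theorem gallagerMean_self {s a : ℝ} (hs : 0 < s) (ha : 0 ≤ a) : gallagerMean s a a = a := by
  rw [gallagerMean, ← add_mul, add_halves, one_mul, ← rpow_mul ha, one_div_mul_cancel hs.ne',
    rpow_one]

theorem arith_mean_lt_gallagerMean {s a b : ℝ} (hs : 0 < s) (hs1 : s < 1) (ha : 0 ≤ a)
    (hb : 0 ≤ b) (hab : a ≠ b) : (a + b) / 2 < gallagerMean s a b := by
  have h := (strictConvexOn_rpow ((one_lt_div hs).2 hs1)).2 (mem_Ici.2 ha) (mem_Ici.2 hb) hab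
    one_half_pos one_half_pos (add_halves 1)
  simp only [smul_eq_mul] at h
  have hq : 0 ≤ 1 / 2 * a + 1 / 2 * b := by positivity
  have h' := rpow_lt_rpow (by positivity) h hs
  rw [← rpow_mul hq, one_div_mul_cancel hs.ne', rpow_one] at h'
  rw [gallagerMean]
  linarith

theorem arith_mean_le_gallagerMean {s a b : ℝ} (hs : 0 < s) (hs1 : s < 1) (ha : 0 ≤ a)
    (hb : 0 ≤ b) : (a + b) / 2 ≤ gallagerMean s a b := by
  rcases eq_or_ne a b with rfl | hab
  · rw [gallagerMean_self hs ha]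
    linarith
  · exact (arith_mean_lt_gallagerMean hs hs1 ha hb hab).le

theorem gallagerMean_eq_half_rpow_mul {s a b : ℝ} (ha : 0 ≤ a) (hb : 0 ≤ b) :
    gallagerMean s a b = (1 / 2) ^ s * (a ^ (1 / s) + b ^ (1 / s)) ^ s := by
  rw [gallagerMean, ← mul_add, mul_rpow (by norm_num) (by positivity)]

theorem gallagerMean_two_zero {s : ℝ} (hs : 0 < s) : gallagerMean s 2 0 = 2 ^ (1 - s) := by
  have : 1 / s ≠ 0 := by positivity
  rw [gallagerMean_eq_half_rpow_mul two_pos.le le_rfl, zero_rpow this, add_zero,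
    ← rpow_mul two_pos.le, one_div_mul_cancel hs.ne', rpow_one, rpow_sub two_pos, rpow_one,
    div_rpow one_pos.le two_pos.le, one_rpow]
  ring

theorem gallagerMean_mul_le {s t a b : ℝ} (hs : 0 < s) (hst : s ≤ t) (ha : 0 ≤ a) (hb : 0 ≤ b) :
    gallagerMean s a b * gallagerMean t 2 0 ≤ gallagerMean s 2 0 * gallagerMean t a b := by
  have ht := hs.trans_le hst
  have h : (a ^ (1 / s) + b ^ (1 / s)) ^ (1 / (1 / s))
      ≤ (a ^ (1 / t) + b ^ (1 / t)) ^ (1 / (1 / t)) := mod_cast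
    NNReal.rpow_add_rpow_le ⟨a, ha⟩ ⟨b, hb⟩ (one_div_pos.2 ht) (one_div_le_one_div_of_le hs hst)
  rw [one_div_one_div, one_div_one_div] at h
  have h2 {r : ℝ} (hr : 0 < r) : gallagerMean r 2 0 = 2 * (1 / 2) ^ r := by
    rw [gallagerMean_two_zero hr, rpow_sub two_pos, rpow_one, div_rpow one_pos.le two_pos.le,
      one_rpow]
    ring
  rw [h2 hs, h2 ht, gallagerMean_eq_half_rpow_mul ha hb, gallagerMean_eq_half_rpow_mul ha hb]
  calc _ = 2 * (1 / 2) ^ s * (1 / 2) ^ t * (a ^ (1 / s) + b ^ (1 / s)) ^ s := by ring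
    _ ≤ 2 * (1 / 2) ^ s * (1 / 2) ^ t * (a ^ (1 / t) + b ^ (1 / t)) ^ t := by gcongr
    _ = _ := by ring

theorem differentiableAt_gallagerMean {s a b : ℝ} (hs : 0 < s) (ha : 0 ≤ a) (hb : 0 ≤ b) :
    DifferentiableAt ℝ (fun r => gallagerMean r a b) s := by
  have hz {r : ℝ} (hr : 0 < r) : (0:ℝ) ^ (1 / r) = 0 := zero_rpow (by positivity)
  have hpow {c : ℝ} (hc : 0 ≤ c) : DifferentiableAt ℝ (fun r : ℝ => c ^ (1 / r)) s := by
    rcases hc.eq_or_lt with rfl | hc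
    · refine (differentiableAt_const (0:ℝ)).congr_of_eventuallyEq ?_
      filter_upwards [lt_mem_nhds hs] with r hr using hz hr
    · have hinv : DifferentiableAt ℝ (fun r : ℝ => 1 / r) s := by
        simpa using differentiableAt_inv hs.ne'
      exact (differentiableAt_const c).rpow hinv hc.ne'
  by_cases hab : a = 0 ∧ b = 0
  · obtain ⟨rfl, rfl⟩ := hab
    refine (differentiableAt_const (0:ℝ)).congr_of_eventuallyEq ?_
    filter_upwards [lt_mem_nhds hs] with r hr using gallagerMean_self hr le_rfl
  · refine (((hpow ha).const_mul _).add ((hpow hb).const_mul _)).rpow differentiableAt_id ?_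
    rcases ha.eq_or_lt with rfl | ha
    · have hb : 0 < b := hb.lt_of_ne fun h => hab ⟨rfl, h.symm⟩
      exact (add_pos_of_nonneg_of_pos (by positivity) (by positivity)).ne'
    · exact (add_pos_of_pos_of_nonneg (by positivity) (by positivity)).ne'

theorem deriv_le_deriv_of_sub_le_sub {f g : ℝ → ℝ} {l a : ℝ} (hl : l < a)
    (hf : DifferentiableAt ℝ f a) (hg : DifferentiableAt ℝ g a)
    (h : ∀ r ∈ Ioo l a, f a - g a ≤ f r - g r) : deriv f a ≤ deriv g a := by
  have hd := (hf.hasDerivAt.sub hg.hasDerivAt).hasDerivWithinAt (s := Iio a)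
  have hlim := hasDerivWithinAt_iff_tendsto_slope.1 hd
  rw [sdiff_singleton_eq_self (by simp)] at hlim
  refine sub_nonpos.1 (le_of_tendsto hlim ?_)
  filter_upwards [Ioo_mem_nhdsLT hl] with r hr
  rw [slope_def_field]
  exact div_nonpos_of_nonneg_of_nonpos (sub_nonneg.2 (h r hr)) (by linarith [hr.2])

theorem bec_pos {s ε : ℝ} (hε : ε ∈ Icc (0:ℝ) 1) : 0 < (2:ℝ) ^ s * (1 - ε) + ε := by
  have h2 := rpow_pos_of_pos two_pos s
  rcases hε.1.eq_or_lt with rfl | h0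
  · simpa
  · have : 0 ≤ 1 - ε := by linarith [hε.2]
    positivity

namespace BDMC

/-- The sum inside the logarithm in the definition of `E0`, as a function of `s = 1 + ρ`. -/
noncomputable def meanSum (W : BDMC) (s : ℝ) : ℝ := ∑ y, gallagerMean s (W.W0 y) (W.W1 y)

theorem sum_half_add (W : BDMC) : ∑ y, (W.W0 y + W.W1 y) / 2 = 1 := by
  rw [← Finset.sum_div, Finset.sum_add_distrib, W.sum_W0, W.sum_W1]
  norm_num

theorem one_le_meanSum (W : BDMC) {s : ℝ} (hs : 0 < s) (hs1 : s < 1) : 1 ≤ W.meanSum s := by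
  rw [← W.sum_half_add]
  exact Finset.sum_le_sum fun y _ =>
    arith_mean_le_gallagerMean hs hs1 (W.W0_nonneg y) (W.W1_nonneg y)

theorem differentiableAt_meanSum (W : BDMC) {s : ℝ} (hs : 0 < s) :
    DifferentiableAt ℝ W.meanSum s :=
  DifferentiableAt.fun_sum fun y _ =>
    differentiableAt_gallagerMean hs (W.W0_nonneg y) (W.W1_nonneg y)

theorem meanSum_eq_one_of_le (W : BDMC) {s t : ℝ} (hs : 0 < s) (ht : 0 < t) (ht1 : t < 1)
    (h : W.meanSum t ≤ 1) : W.meanSum s = 1 := by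
  have hle : ∀ y ∈ Finset.univ, (W.W0 y + W.W1 y) / 2 ≤ gallagerMean t (W.W0 y) (W.W1 y) :=
    fun y _ => arith_mean_le_gallagerMean ht ht1 (W.W0_nonneg y) (W.W1_nonneg y)
  have heq := (Finset.sum_eq_sum_iff_of_le hle).1
    (W.sum_half_add.trans (le_antisymm h (W.one_le_meanSum ht ht1)).symm)
  rw [← W.sum_half_add]
  refine Finset.sum_congr rfl fun y hy => ?_
  have hab : W.W0 y = W.W1 y := by
    by_contra hne
    exact (arith_mean_lt_gallagerMean ht ht1 (W.W0_nonneg y) (W.W1_nonneg y) hne).ne (heq y hy)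
  rw [hab, gallagerMean_self hs (W.W1_nonneg y)]
  ring

theorem meanSum_mul_le_of_le_bsc (W : BDMC) {s t x : ℝ} (hs : 0 < s) (hst : s < t) (ht : t < 1)
    (hx : x ∈ Icc (0:ℝ) (1/2)) (h : W.meanSum t ≤ gallagerMean t (2 * (1 - x)) (2 * x)) :
    W.meanSum s * gallagerMean t (2 * (1 - x)) (2 * x)
      ≤ gallagerMean s (2 * (1 - x)) (2 * x) * W.meanSum t := by
  have ht0 := hs.trans hst
  rcases hx.1.eq_or_lt with rfl | hx0
  · rw [sub_zero, mul_one, mul_zero, meanSum, meanSum, Finset.sum_mul, Finset.mul_sum]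
    exact Finset.sum_le_sum fun y _ =>
      gallagerMean_mul_le hs hst.le (W.W0_nonneg y) (W.W1_nonneg y)
  rcases hx.2.eq_or_lt with rfl | hx1
  · have hγ {r : ℝ} (hr : 0 < r) : gallagerMean r (2 * (1 - 1 / 2)) (2 * (1 / 2)) = 1 := by
      norm_num [gallagerMean_self hr]
    rw [hγ ht0] at h
    rw [hγ hs, hγ ht0, W.meanSum_eq_one_of_le hs ht0 ht h, W.meanSum_eq_one_of_le ht0 ht0 ht h]
  obtain ⟨c, hc, hle⟩ := exists_gallagerMean_tangent hs hst ht hx0 hx1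
  have hsum := Finset.sum_le_sum fun y (_ : y ∈ Finset.univ) =>
    hle _ _ (W.W0_nonneg y) (W.W1_nonneg y)
  rw [← Finset.mul_sum, Finset.sum_sub_distrib, Finset.sum_sub_distrib, ← Finset.sum_mul,
    ← Finset.sum_mul, W.sum_half_add, one_mul, one_mul] at hsum
  change W.meanSum s - _ ≤ c * (W.meanSum t - _) at hsum
  have hγ : 0 ≤ gallagerMean t (2 * (1 - x)) (2 * x) :=
    gallagerMean_nonneg (by linarith) (by linarith)
  nlinarith [mul_le_mul_of_nonneg_right hsum hγ, mul_nonneg (sub_nonneg.2 h) (sub_nonneg.2 hc)]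

theorem bec_mul_meanSum_le_of_bec_le (W : BDMC) {s t ε : ℝ} (hs : 0 < s) (hst : s < t)
    (ht : t < 1) (hε : ε ∈ Icc (0:ℝ) 1) (h : 2 ^ (1 - t) * (1 - ε) + ε ≤ W.meanSum t) :
    (2 ^ (1 - s) * (1 - ε) + ε) * W.meanSum t ≤ W.meanSum s * (2 ^ (1 - t) * (1 - ε) + ε) := by
  have hsum := Finset.sum_le_sum fun y (_ : y ∈ Finset.univ) =>
    gallagerMean_chord hs hst ht (W.W0_nonneg y) (W.W1_nonneg y)
  rw [← Finset.sum_mul, ← Finset.sum_mul, Finset.sum_sub_distrib, Finset.sum_sub_distrib,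
    W.sum_half_add] at hsum
  change (W.meanSum t - 1) * _ ≤ (W.meanSum s - 1) * _ at hsum
  have hκ : (2:ℝ) ^ (1 - t) ≤ 2 ^ (1 - s) :=
    rpow_le_rpow_of_exponent_le one_le_two (by linarith)
  have hκt : 1 < (2:ℝ) ^ (1 - t) := one_lt_rpow one_lt_two (by linarith)
  have hpos := bec_pos (s := 1 - t) hε
  set F := W.meanSum t
  set G := W.meanSum s
  set A := (2:ℝ) ^ (1 - t)
  set B := (2:ℝ) ^ (1 - s)
  refine le_of_mul_le_mul_right ?_ (sub_pos.2 hκt)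
  nlinarith [mul_le_mul_of_nonneg_left hsum hpos.le, mul_nonneg (sub_nonneg.2 hκ) (sub_nonneg.2 h)]

end BDMC

theorem E0_eq_neg_log_meanSum (ρ : ℝ) (W : BDMC) : E0 ρ W = -log (W.meanSum (1 + ρ)) := rfl

theorem E0bsc_eq_neg_log_gallagerMean {ρ x : ℝ} (hρ : -1 < ρ) (hx : x ∈ Icc (0:ℝ) (1/2)) :
    E0bsc ρ x = -log (gallagerMean (1 + ρ) (2 * (1 - x)) (2 * x)) := by
  have hs : 0 < 1 + ρ := by linarith
  have hx0 := hx.1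
  have hx1 : 0 ≤ 1 - x := by linarith [hx.2]
  rw [gallagerMean_eq_half_rpow_mul (by positivity) (by positivity), mul_rpow two_pos.le hx1,
    mul_rpow two_pos.le hx0, ← mul_add, mul_rpow (by positivity) (by positivity),
    ← rpow_mul two_pos.le, one_div_mul_cancel hs.ne', ← mul_assoc, E0bsc, add_comm (x ^ _),
    show -ρ = 1 - (1 + ρ) by ring, rpow_sub two_pos, div_rpow one_pos.le two_pos.le, one_rpow]
  congr 3
  ring

theorem E0bec_eq_neg_log (ρ ε : ℝ) :
    E0bec ρ ε = -log (2 ^ (1 - (1 + ρ)) * (1 - ε) + ε) := by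
  rw [E0bec, sub_add_cancel_left]

theorem bsc_pos {s x : ℝ} (hs : 0 < s) (hs1 : s < 1) (hx : x ∈ Icc (0:ℝ) (1/2)) :
    0 < gallagerMean s (2 * (1 - x)) (2 * x) := by
  have := arith_mean_le_gallagerMean hs hs1 (a := 2 * (1 - x)) (b := 2 * x)
    (by linarith [hx.2]) (by linarith [hx.1])
  linarith

theorem neg_log_sub_neg_log_le {a b c d : ℝ} (ha : 0 < a) (hb : 0 < b) (hc : 0 < c) (hd : 0 < d)
    (h : c * b ≤ a * d) : -log a - -log b ≤ -log c - -log d := by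
  have := log_le_log (mul_pos hc hb) h
  rw [log_mul hc.ne' hb.ne', log_mul ha.ne' hd.ne'] at this
  linarith

theorem E0bec_sub_E0_le {W : BDMC} {ε ρ r : ℝ} (hε : ε ∈ Icc (0:ℝ) 1) (hr : -1 < r)
    (hrρ : r < ρ) (hρ : ρ < 0) (h : E0 ρ W ≤ E0bec ρ ε) :
    E0bec ρ ε - E0 ρ W ≤ E0bec r ε - E0 r W := by
  have hs : 0 < 1 + r := by linarith
  have hF := W.one_le_meanSum (s := 1 + ρ) (by linarith) (by linarith)
  have hG := W.one_le_meanSum hs (by linarith)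
  rw [E0bec_eq_neg_log, E0_eq_neg_log_meanSum, neg_le_neg_iff,
    log_le_log_iff (bec_pos hε) (by linarith)] at h
  rw [E0bec_eq_neg_log, E0bec_eq_neg_log, E0_eq_neg_log_meanSum, E0_eq_neg_log_meanSum]
  refine neg_log_sub_neg_log_le (bec_pos hε) (by linarith) (bec_pos hε) (by linarith) ?_
  rw [mul_comm (_ + _) (W.meanSum (1 + r))]
  exact W.bec_mul_meanSum_le_of_bec_le hs (by linarith) (by linarith) hε h

theorem E0_sub_E0bsc_le {W : BDMC} {x ρ r : ℝ} (hx : x ∈ Icc (0:ℝ) (1/2)) (hr : -1 < r)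
    (hrρ : r < ρ) (hρ : ρ < 0) (h : E0bsc ρ x ≤ E0 ρ W) :
    E0 ρ W - E0bsc ρ x ≤ E0 r W - E0bsc r x := by
  have hs : 0 < 1 + r := by linarith
  have ht : 0 < 1 + ρ := by linarith
  have hF := W.one_le_meanSum ht (by linarith)
  have hG := W.one_le_meanSum hs (by linarith)
  have hγ := bsc_pos ht (by linarith) hx
  rw [E0bsc_eq_neg_log_gallagerMean (by linarith) hx] at h ⊢
  rw [E0_eq_neg_log_meanSum, neg_le_neg_iff, log_le_log_iff (by linarith) hγ] at h
  rw [E0bsc_eq_neg_log_gallagerMean hr hx, E0_eq_neg_log_meanSum, E0_eq_neg_log_meanSum]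
  refine neg_log_sub_neg_log_le (by linarith) hγ (by linarith) (bsc_pos hs (by linarith) hx) ?_
  rw [mul_comm (W.meanSum (1 + ρ))]
  exact W.meanSum_mul_le_of_le_bsc hs (by linarith) (by linarith) hx h

theorem differentiableAt_E0 (W : BDMC) {ρ : ℝ} (hρ : ρ ∈ Ioo (-1:ℝ) 0) :
    DifferentiableAt ℝ (fun r => E0 r W) ρ := by
  have hs : 0 < 1 + ρ := by linarith [hρ.1]
  have hF := W.one_le_meanSum hs (by linarith [hρ.2])
  exact (((W.differentiableAt_meanSum hs).comp ρ (differentiableAt_id.const_add 1)).log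
    (by dsimp; linarith)).neg

theorem differentiableAt_E0bec {ε : ℝ} (hε : ε ∈ Icc (0:ℝ) 1) (ρ : ℝ) :
    DifferentiableAt ℝ (fun r => E0bec r ε) ρ := by
  have h : DifferentiableAt ℝ (fun r : ℝ => (2:ℝ) ^ (-r)) ρ :=
    (differentiableAt_const (2:ℝ)).rpow differentiableAt_id.neg two_ne_zero
  exact (((h.mul_const (1 - ε)).add_const ε).log (bec_pos hε).ne').neg

theorem differentiableAt_E0bsc {x ρ : ℝ} (hx : x ∈ Icc (0:ℝ) (1/2)) (hρ : ρ ∈ Ioo (-1:ℝ) 0) :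
    DifferentiableAt ℝ (fun r => E0bsc r x) ρ := by
  have hs : 0 < 1 + ρ := by linarith [hρ.1]
  have hd := (differentiableAt_gallagerMean hs (a := 2 * (1 - x)) (b := 2 * x)
    (by linarith [hx.2]) (by linarith [hx.1])).comp ρ (differentiableAt_id.const_add 1)
  refine ((hd.log (bsc_pos hs (by linarith [hρ.2]) hx).ne').neg).congr_of_eventuallyEq ?_
  filter_upwards [lt_mem_nhds hρ.1] with r hr using E0bsc_eq_neg_log_gallagerMean hr hx

/-- Theorem 1, Part 2: if `ρ₁ ∈ (−1,0)` and
`E₀(ρ₁, BSC_x) ≤ E₀(ρ₁, W) ≤ E₀(ρ₁, BEC_ε)`, then for every `ρ₂ ∈ (−1, ρ₁]`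
the rates are ordered with BEC smallest and BSC largest, while the `E₀` values
remain ordered with BSC smallest and BEC largest. -/
theorem extremality_part2 (W : BDMC) (ε x ρ₁ : ℝ)
    (hε : ε ∈ Set.Icc (0:ℝ) 1) (hx : x ∈ Set.Icc (0:ℝ) (1/2))
    (hρ₁ : ρ₁ ∈ Set.Ioo (-1:ℝ) 0)
    (hBSC : E0bsc ρ₁ x ≤ E0 ρ₁ W) (hBEC : E0 ρ₁ W ≤ E0bec ρ₁ ε) :
    ∀ ρ₂ ∈ Set.Ioc (-1:ℝ) ρ₁,
      (Rbec ρ₂ ε ≤ RW ρ₂ W ∧ RW ρ₂ W ≤ Rbsc ρ₂ x) ∧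
      (E0bsc ρ₂ x ≤ E0 ρ₂ W ∧ E0 ρ₂ W ≤ E0bec ρ₂ ε) := by
  have hlow {ρ : ℝ} (hρ : ρ ∈ Set.Ioc (-1:ℝ) ρ₁) : E0bsc ρ x ≤ E0 ρ W := by
    rcases hρ.2.eq_or_lt with rfl | h
    · exact hBSC
    · linarith [E0_sub_E0bsc_le hx hρ.1 h hρ₁.2 hBSC]
  have hupp {ρ : ℝ} (hρ : ρ ∈ Set.Ioc (-1:ℝ) ρ₁) : E0 ρ W ≤ E0bec ρ ε := by
    rcases hρ.2.eq_or_lt with rfl | h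
    · exact hBEC
    · linarith [E0bec_sub_E0_le hε hρ.1 h hρ₁.2 hBEC]
  intro ρ₂ hρ₂
  have hneg : ρ₂ < 0 := hρ₂.2.trans_lt hρ₁.2
  have hW := differentiableAt_E0 W ⟨hρ₂.1, hneg⟩
  refine ⟨⟨?_, ?_⟩, hlow hρ₂, hupp hρ₂⟩
  · exact deriv_le_deriv_of_sub_le_sub hρ₂.1 (differentiableAt_E0bec hε ρ₂) hW
      fun r hr => E0bec_sub_E0_le hε hr.1 hr.2 hneg (hupp hρ₂)
  · exact deriv_le_deriv_of_sub_le_sub hρ₂.1 hW (differentiableAt_E0bsc hx ⟨hρ₂.1, hneg⟩)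
      fun r hr => E0_sub_E0bsc_le hx hr.1 hr.2 hneg (hlow hρ₂)
end

section
/- (Theorem 1, Part 3, case (g)–(g′).) Let W be a B-DMC with finite output alphabet, ε ∈ [0, 1], x ∈ [0, 1/2], and fix ρ₁ ∈ (0, 1]. If E0(ρ₁, BSC_x) ≤ E0(ρ₁, W) ≤ E0(ρ₁, BEC_ε), then for every ρ₂ ≥ ρ₁ one has E0(ρ₂, BSC_x) ≤ E0(ρ₂, W) ≤ E0(ρ₂, BEC_ε). -/
open Real Set

/-- The contribution to `exp (-E₀)` of a binary symmetric channel with bias `z`. -/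
noncomputable def gallagerKernel (ρ z : ℝ) : ℝ :=
  ((1/2) * (1 + z) ^ (1/(1+ρ)) + (1/2) * (1 - z) ^ (1/(1+ρ))) ^ (1+ρ)

lemma convexOn_sinh_Ici : ConvexOn ℝ (Ici 0) sinh := by
  refine MonotoneOn.convexOn_of_deriv (convex_Ici 0) continuous_sinh.continuousOn
    differentiable_sinh.differentiableOn ?_
  rw [Real.deriv_sinh]
  intro a ha b hb hab
  rw [interior_Ici, mem_Ioi] at ha hb
  rw [cosh_le_cosh, abs_of_pos ha, abs_of_pos hb]
  exact hab

lemma sinh_mul_le {t u : ℝ} (ht : t ∈ Icc (0:ℝ) 1) (hu : 0 ≤ u) :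
    sinh (t * u) ≤ t * sinh u := by
  have h := convexOn_sinh_Ici.2 (mem_Ici.2 le_rfl) (mem_Ici.2 hu)
    (sub_nonneg.2 ht.2) ht.1 (sub_add_cancel 1 t)
  simpa using h

/-- Chord slopes of `sinh` with left endpoint `-u`. -/
lemma sinh_chord_le {a b u : ℝ} (hu : 0 ≤ u) (ha0 : 0 ≤ a) (ha1 : a < 1)
    (hba : b ≤ a) (hb : -1 < b) :
    (1 - a) * (sinh u - sinh (b * u)) ≤ (1 - b) * (sinh u - sinh (a * u)) := by
  have hS : 0 ≤ sinh u := sinh_nonneg_iff.2 hu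
  rcases le_total 0 b with h0 | h0
  · have hb1 : 0 < 1 - b := by linarith
    have h := convexOn_sinh_Ici.2 (mem_Ici.2 (mul_nonneg h0 hu)) (mem_Ici.2 hu)
      (div_nonneg (sub_nonneg.2 ha1.le) hb1.le) (div_nonneg (sub_nonneg.2 hba) hb1.le)
      (by field_simp; ring)
    simp only [smul_eq_mul] at h
    rw [show (1 - a) / (1 - b) * (b * u) + (a - b) / (1 - b) * u = a * u by
      field_simp; ring] at h
    rw [show (1 - a) / (1 - b) * sinh (b * u) + (a - b) / (1 - b) * sinh u
      = ((1 - a) * sinh (b * u) + (a - b) * sinh u) / (1 - b) by ring, le_div_iff₀ hb1] at h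
    linarith
  · have h1 := sinh_mul_le (t := a) ⟨ha0, ha1.le⟩ hu
    have h2 := sinh_mul_le (t := -b) ⟨by linarith, by linarith⟩ hu
    rw [neg_mul, sinh_neg] at h2
    nlinarith [mul_le_mul_of_nonneg_left h2 (by linarith : 0 ≤ 1 - a),
      mul_le_mul_of_nonneg_left h1 (by linarith : 0 ≤ 1 - b)]

lemma two_mul_cosh_mul_sinh (s u : ℝ) :
    2 * (cosh (s * u) * sinh ((1 - s) * u)) = sinh u - sinh ((2 * s - 1) * u) := by
  have h1 := sinh_add ((1 - s) * u) (s * u)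
  have h2 := sinh_sub (s * u) ((1 - s) * u)
  rw [show (1 - s) * u + s * u = u by ring] at h1
  rw [show s * u - (1 - s) * u = (2 * s - 1) * u by ring] at h2
  rw [h1, h2]; ring

/-- Logarithmic derivative of `u ↦ cosh (s u) ^ (1/s - 1) * sinh ((1 - s) u)`. -/
lemma mul_tanh_add_coth {s u : ℝ} (h : sinh ((1 - s) * u) ≠ 0) :
    (1 - s) * (sinh (s * u) / cosh (s * u) + cosh ((1 - s) * u) / sinh ((1 - s) * u))
      = (1 - s) * (cosh u / (cosh (s * u) * sinh ((1 - s) * u))) := by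
  have hc := (cosh_pos (s * u)).ne'
  have h1 := cosh_add (s * u) ((1 - s) * u)
  rw [show s * u + (1 - s) * u = u by ring] at h1
  rw [h1]; field_simp; ring

lemma logDeriv_ratio_le {s t u : ℝ} (hu : 0 < u) (ht : 0 < t) (hts : t ≤ s)
    (hs : 1 / 2 ≤ s) (hs1 : s < 1) :
    (1 - s) * (sinh (s * u) / cosh (s * u) + cosh ((1 - s) * u) / sinh ((1 - s) * u)) ≤
    (1 - t) * (sinh (t * u) / cosh (t * u) + cosh ((1 - t) * u) / sinh ((1 - t) * u)) := by
  have hSs : 0 < sinh ((1 - s) * u) := sinh_pos_iff.2 (mul_pos (by linarith) hu)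
  have hSt : 0 < sinh ((1 - t) * u) := sinh_pos_iff.2 (mul_pos (by linarith) hu)
  rw [mul_tanh_add_coth hSs.ne', mul_tanh_add_coth hSt.ne', ← mul_div_assoc, ← mul_div_assoc,
    div_le_div_iff₀ (mul_pos (cosh_pos _) hSs) (mul_pos (cosh_pos _) hSt)]
  have h := sinh_chord_le hu.le (a := 2 * s - 1) (b := 2 * t - 1) (by linarith) (by linarith)
    (by linarith) (by linarith)
  rw [← two_mul_cosh_mul_sinh, ← two_mul_cosh_mul_sinh] at h
  nlinarith [mul_le_mul_of_nonneg_left h (cosh_pos u).le]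

/-- Minus the derivative of `gallagerKernel ρ ∘ tanh` at `u`, up to the factor `cosh u ^ 2`. -/
noncomputable def kernelSlope (ρ u : ℝ) : ℝ :=
  cosh (1/(1+ρ) * u) ^ ρ * sinh ((1 - 1/(1+ρ)) * u)

lemma one_sub_pos {ρ : ℝ} (h : 0 < ρ) : 0 < 1 - 1/(1+ρ) := by
  have : 1/(1+ρ) < 1 := by rw [div_lt_one (by linarith)]; linarith
  linarith

lemma kernelSlope_pos {ρ u : ℝ} (hρ : 0 < ρ) (hu : 0 < u) : 0 < kernelSlope ρ u :=
  mul_pos (rpow_pos_of_pos (cosh_pos _) _) (sinh_pos_iff.2 (mul_pos (one_sub_pos hρ) hu))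

lemma hasDerivAt_log_kernelSlope {ρ u : ℝ} (hρ : 0 < ρ) (hu : 0 < u) :
    HasDerivAt (fun v => log (kernelSlope ρ v))
      ((1 - 1/(1+ρ)) * (sinh (1/(1+ρ) * u) / cosh (1/(1+ρ) * u)
        + cosh ((1 - 1/(1+ρ)) * u) / sinh ((1 - 1/(1+ρ)) * u))) u := by
  have hS : 0 < sinh ((1 - 1/(1+ρ)) * u) := sinh_pos_iff.2 (mul_pos (one_sub_pos hρ) hu)
  have hC := cosh_pos (1/(1+ρ) * u)
  have e : (fun v => log (kernelSlope ρ v)) =ᶠ[nhds u] fun v =>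
      ρ * log (cosh (1/(1+ρ) * v)) + log (sinh ((1 - 1/(1+ρ)) * v)) := by
    filter_upwards [lt_mem_nhds hu] with v hv
    rw [kernelSlope, log_mul (rpow_pos_of_pos (cosh_pos _) _).ne'
      (sinh_pos_iff.2 (mul_pos (one_sub_pos hρ) hv)).ne', log_rpow (cosh_pos _)]
  have h1 := (((hasDerivAt_id u).const_mul (1/(1+ρ))).cosh.log hC.ne').const_mul ρ
  have h2 := ((hasDerivAt_id u).const_mul (1 - 1/(1+ρ))).sinh.log hS.ne'
  refine ((h1.add h2).congr_of_eventuallyEq e).congr_deriv ?_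
  have hρ' : 1 - 1/(1+ρ) = ρ * (1/(1+ρ)) := by field_simp; ring
  simp only [id, mul_one, mul_add]
  congr 1
  · rw [hρ']; ring
  · ring

lemma kernelSlope_ratio_mono {ρ₁ ρ₂ u v : ℝ} (h0 : 0 < ρ₁) (h1 : ρ₁ ≤ 1) (h : ρ₁ ≤ ρ₂)
    (hu : 0 < u) (huv : u ≤ v) :
    kernelSlope ρ₂ u * kernelSlope ρ₁ v ≤ kernelSlope ρ₂ v * kernelSlope ρ₁ u := by
  have h2 : 0 < ρ₂ := h0.trans_le h
  have hd : ∀ w ∈ Ioi (0:ℝ), HasDerivAt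
      (fun w => log (kernelSlope ρ₂ w) - log (kernelSlope ρ₁ w)) _ w := fun w hw =>
    (hasDerivAt_log_kernelSlope h2 hw).sub (hasDerivAt_log_kernelSlope h0 hw)
  have hm : MonotoneOn (fun w => log (kernelSlope ρ₂ w) - log (kernelSlope ρ₁ w)) (Ioi 0) := by
    refine monotoneOn_of_deriv_nonneg (convex_Ioi 0)
      (fun w hw => (hd w hw).continuousAt.continuousWithinAt)
      (fun w hw => (hd w (interior_subset hw)).differentiableAt.differentiableWithinAt) ?_
    intro w hw
    have hw' : 0 < w := interior_subset hw
    rw [(hd w hw').deriv, sub_nonneg]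
    refine logDeriv_ratio_le hw' (by positivity) ?_ ?_ (by linarith [one_sub_pos h0])
    · exact one_div_le_one_div_of_le (by linarith) (by linarith)
    · exact one_div_le_one_div_of_le (by linarith) (by linarith)
  have := hm hu (hu.trans_le huv) huv
  have hv := hu.trans_le huv
  have p1 := kernelSlope_pos h0 hu
  have p2 := kernelSlope_pos h2 hu
  have p3 := kernelSlope_pos h0 hv
  have p4 := kernelSlope_pos h2 hv
  rw [← log_le_log_iff (by positivity) (by positivity), log_mul p2.ne' p3.ne',
    log_mul p4.ne' p1.ne']
  simp only at this
  linarith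

lemma gallagerKernel_tanh {ρ : ℝ} (hρ : 0 < ρ) (u : ℝ) :
    gallagerKernel ρ (tanh u) = cosh (1/(1+ρ) * u) ^ (1+ρ) / cosh u := by
  have hc := cosh_pos u
  have e1 : 1 + tanh u = exp u / cosh u := by
    rw [tanh_eq_sinh_div_cosh, ← cosh_add_sinh]; field_simp
  have e2 : 1 - tanh u = exp (-u) / cosh u := by
    rw [tanh_eq_sinh_div_cosh, ← cosh_sub_sinh]; field_simp
  rw [gallagerKernel, e1, e2, div_rpow (exp_pos _).le hc.le, div_rpow (exp_pos _).le hc.le,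
    ← exp_mul, ← exp_mul,
    show (1/2) * (exp (u * (1/(1+ρ))) / cosh u ^ (1/(1+ρ)))
      + (1/2) * (exp (-u * (1/(1+ρ))) / cosh u ^ (1/(1+ρ)))
      = cosh (1/(1+ρ) * u) / cosh u ^ (1/(1+ρ)) by
        rw [cosh_eq (1/(1+ρ) * u)]; ring_nf,
    div_rpow (cosh_pos _).le (rpow_nonneg hc.le _), ← rpow_mul hc.le,
    one_div_mul_cancel (by linarith), rpow_one]

lemma hasDerivAt_artanh {z : ℝ} (hz : z ∈ Ioo (-1:ℝ) 1) :
    HasDerivAt artanh (1 / (1 - z ^ 2)) z := by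
  have h1 : 1 + z ≠ 0 := by linarith [hz.1]
  have h2 : 1 - z ≠ 0 := by linarith [hz.2]
  have e : artanh =ᶠ[nhds z] fun v => 1 / 2 * log ((1 + v) / (1 - v)) := by
    filter_upwards [isOpen_Ioo.mem_nhds hz] with v hv
    exact artanh_eq_half_log (Ioo_subset_Icc_self hv)
  have h := ((((hasDerivAt_id z).const_add 1).div ((hasDerivAt_id z).const_sub 1) h2).log
    (div_ne_zero h1 h2)).const_mul (1 / 2)
  refine (h.congr_of_eventuallyEq e).congr_deriv ?_
  rw [show 1 - z ^ 2 = (1 + z) * (1 - z) by ring]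
  simp only [id, Pi.div_apply]
  field_simp
  ring

lemma hasDerivAt_gallagerKernel {ρ z : ℝ} (hρ : 0 < ρ) (hz : z ∈ Ioo (0:ℝ) 1) :
    HasDerivAt (gallagerKernel ρ)
      (-(kernelSlope ρ (artanh z) / (cosh (artanh z) ^ 2 * (1 - z ^ 2)))) z := by
  have hz' : z ∈ Ioo (-1:ℝ) 1 := ⟨by linarith [hz.1], hz.2⟩
  have e : gallagerKernel ρ =ᶠ[nhds z]
      fun v => cosh (1/(1+ρ) * artanh v) ^ (1+ρ) / cosh (artanh v) := by
    filter_upwards [isOpen_Ioo.mem_nhds hz'] with v hv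
    rw [← gallagerKernel_tanh hρ, tanh_artanh hv]
  have hd := hasDerivAt_artanh hz'
  set u := artanh z with hu
  have hc := cosh_pos u
  have hC := cosh_pos (1/(1+ρ) * u)
  have h1 := (((hd.const_mul (1/(1+ρ))).cosh).rpow_const (p := 1+ρ) (Or.inl hC.ne')).div
    hd.cosh hc.ne'
  refine (h1.congr_of_eventuallyEq e).congr_deriv ?_
  have hS := sinh_sub u (1/(1+ρ) * u)
  rw [show u - 1/(1+ρ) * u = (1 - 1/(1+ρ)) * u by ring] at hS
  have hz2 : 1 - z ^ 2 ≠ 0 := by nlinarith [hz.1, hz.2]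
  have hρ1 : 1 + ρ ≠ 0 := by linarith
  rw [kernelSlope, hS, rpow_add hC, rpow_one, show 1 + ρ - 1 = ρ by ring, ← hu]
  generalize cosh (1/(1+ρ) * u) = C at *
  generalize sinh (1/(1+ρ) * u) = S at *
  field_simp
  ring

lemma continuous_gallagerKernel {ρ : ℝ} (hρ : 0 < ρ) : Continuous (gallagerKernel ρ) := by
  have : 0 ≤ 1/(1+ρ) := by positivity
  have : 0 ≤ 1+ρ := by positivity
  unfold gallagerKernel
  fun_prop (disch := assumption)

lemma strictAntiOn_gallagerKernel {ρ : ℝ} (hρ : 0 < ρ) :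
    StrictAntiOn (gallagerKernel ρ) (Icc 0 1) := by
  refine strictAntiOn_of_deriv_neg (convex_Icc 0 1) (continuous_gallagerKernel hρ).continuousOn ?_
  intro z hz
  rw [interior_Icc] at hz
  rw [(hasDerivAt_gallagerKernel hρ hz).deriv, neg_lt_zero]
  have := kernelSlope_pos hρ (artanh_pos hz)
  have : 0 < 1 - z ^ 2 := by nlinarith [hz.1, hz.2]
  have := cosh_pos (artanh z)
  positivity

lemma gallagerKernel_three_chord {ρ₁ ρ₂ a b c : ℝ} (h0 : 0 < ρ₁) (h1 : ρ₁ ≤ 1) (h : ρ₁ ≤ ρ₂)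
    (ha : 0 ≤ a) (hab : a < b) (hbc : b < c) (hc : c ≤ 1) :
    (gallagerKernel ρ₂ a - gallagerKernel ρ₂ b) / (gallagerKernel ρ₁ a - gallagerKernel ρ₁ b) ≤
    (gallagerKernel ρ₂ b - gallagerKernel ρ₂ c) / (gallagerKernel ρ₁ b - gallagerKernel ρ₁ c) := by
  have h2 : 0 < ρ₂ := h0.trans_le h
  have key : ∀ p q : ℝ, 0 ≤ p → p < q → q ≤ 1 → ∃ z ∈ Ioo p q,
      (gallagerKernel ρ₂ p - gallagerKernel ρ₂ q) / (gallagerKernel ρ₁ p - gallagerKernel ρ₁ q)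
        = kernelSlope ρ₂ (artanh z) / kernelSlope ρ₁ (artanh z) := by
    intro p q hp hpq hq
    obtain ⟨z, hz, e⟩ := exists_ratio_hasDerivAt_eq_ratio_slope (gallagerKernel ρ₂) _ hpq
      (continuous_gallagerKernel h2).continuousOn
      (fun w hw => hasDerivAt_gallagerKernel h2 ⟨hp.trans_lt hw.1, hw.2.trans_le hq⟩)
      (gallagerKernel ρ₁) _ (continuous_gallagerKernel h0).continuousOn
      (fun w hw => hasDerivAt_gallagerKernel h0 ⟨hp.trans_lt hw.1, hw.2.trans_le hq⟩)
    have hz01 : z ∈ Ioo (0:ℝ) 1 := ⟨hp.trans_lt hz.1, hz.2.trans_le hq⟩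
    have hd := strictAntiOn_gallagerKernel h0 ⟨hp, (hpq.trans_le hq).le⟩ ⟨hp.trans hpq.le, hq⟩ hpq
    have k1 := kernelSlope_pos h0 (artanh_pos hz01)
    have hz2 : 1 - z ^ 2 ≠ 0 := by nlinarith [hz01.1, hz01.2]
    have hcc := (cosh_pos (artanh z)).ne'
    refine ⟨z, hz, ?_⟩
    rw [div_eq_div_iff (sub_pos.2 hd).ne' k1.ne']
    field_simp at e
    linarith
  obtain ⟨z, hz, ez⟩ := key a b ha hab (hbc.le.trans hc)
  obtain ⟨w, hw, ew⟩ := key b c (ha.trans hab.le) hbc hc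
  have hz0 : 0 < z := ha.trans_lt hz.1
  have hzw : z < w := hz.2.trans hw.1
  have hw1 : w < 1 := hw.2.trans_le hc
  have hu := artanh_pos ⟨hz0, hzw.trans hw1⟩
  have huv : artanh z ≤ artanh w := artanh_le_artanh (by linarith) hw1 hzw.le
  rw [ez, ew, div_le_div_iff₀ (kernelSlope_pos h0 hu) (kernelSlope_pos h0 (hu.trans_le huv))]
  exact kernelSlope_ratio_mono h0 h1 h hu huv

/-- `gallagerKernel ρ₂` is a concave increasing function of `gallagerKernel ρ₁`. -/
lemma exists_concaveOn_gallagerKernel {ρ₁ ρ₂ : ℝ} (h0 : 0 < ρ₁) (h1 : ρ₁ ≤ 1) (h : ρ₁ ≤ ρ₂) :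
    ∃ F : ℝ → ℝ, ConcaveOn ℝ (Icc (gallagerKernel ρ₁ 1) (gallagerKernel ρ₁ 0)) F ∧
      MonotoneOn F (Icc (gallagerKernel ρ₁ 1) (gallagerKernel ρ₁ 0)) ∧
      ∀ z ∈ Icc (0:ℝ) 1, F (gallagerKernel ρ₁ z) = gallagerKernel ρ₂ z := by
  have h2 : 0 < ρ₂ := h0.trans_le h
  have sa := strictAntiOn_gallagerKernel h0
  have inv : ∀ t ∈ Icc (gallagerKernel ρ₁ 1) (gallagerKernel ρ₁ 0),
      ∃ z ∈ Icc (0:ℝ) 1, gallagerKernel ρ₁ z = t := fun t ht =>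
    intermediate_value_Icc' zero_le_one (continuous_gallagerKernel h0).continuousOn ht
  let F : ℝ → ℝ := fun t => gallagerKernel ρ₂ (Function.invFunOn (gallagerKernel ρ₁) (Icc 0 1) t)
  have hF : ∀ z ∈ Icc (0:ℝ) 1, F (gallagerKernel ρ₁ z) = gallagerKernel ρ₂ z := fun z hz => by
    simp only [F, sa.injOn.leftInvOn_invFunOn hz]
  refine ⟨F, concaveOn_of_slope_anti_adjacent (convex_Icc _ _) ?_, ?_, hF⟩
  · intro x y z hx hz hxy hyz
    have hy := ordConnected_Icc.out hx hz ⟨hxy.le, hyz.le⟩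
    obtain ⟨c, hc, rfl⟩ := inv x hx
    obtain ⟨b, hb, rfl⟩ := inv y hy
    obtain ⟨a, ha, rfl⟩ := inv z hz
    rw [hF c hc, hF b hb, hF a ha]
    exact gallagerKernel_three_chord h0 h1 h ha.1 ((sa.lt_iff_gt hb ha).1 hyz)
      ((sa.lt_iff_gt hc hb).1 hxy) hc.2
  · intro x hx y hy hxy
    obtain ⟨b, hb, rfl⟩ := inv x hx
    obtain ⟨a, ha, rfl⟩ := inv y hy
    rw [hF b hb, hF a ha]
    exact (strictAntiOn_gallagerKernel h2).antitoneOn ha hb ((sa.le_iff_ge hb ha).1 hxy)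

lemma gallagerKernel_zero (ρ : ℝ) : gallagerKernel ρ 0 = 1 := by
  norm_num [gallagerKernel]

lemma gallagerKernel_one_sub_two_mul {ρ x : ℝ} (hρ : 0 < ρ) (hx0 : 0 ≤ x) (hx1 : x ≤ 1) :
    gallagerKernel ρ (1 - 2 * x) =
      (2:ℝ) ^ (-ρ) * (x ^ (1/(1+ρ)) + (1-x) ^ (1/(1+ρ))) ^ (1+ρ) := by
  have hx1' : 0 ≤ 1 - x := by linarith
  have hb : 0 ≤ x ^ (1/(1+ρ)) + (1-x) ^ (1/(1+ρ)) := by positivity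
  rw [gallagerKernel, show 1 + (1 - 2 * x) = 2 * (1 - x) by ring,
    show 1 - (1 - 2 * x) = 2 * x by ring, mul_rpow zero_le_two hx1', mul_rpow zero_le_two hx0,
    show (1/2) * ((2:ℝ) ^ (1/(1+ρ)) * (1-x) ^ (1/(1+ρ)))
      + (1/2) * ((2:ℝ) ^ (1/(1+ρ)) * x ^ (1/(1+ρ)))
      = ((2:ℝ)⁻¹ * 2 ^ (1/(1+ρ))) * (x ^ (1/(1+ρ)) + (1-x) ^ (1/(1+ρ))) by ring,
    mul_rpow (by positivity) hb, mul_rpow (by positivity) (by positivity),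
    ← rpow_mul zero_le_two, one_div_mul_cancel (by linarith), rpow_one,
    inv_rpow zero_le_two, ← rpow_neg zero_le_two, ← rpow_add_one two_ne_zero]
  ring_nf

lemma gallagerKernel_one {ρ : ℝ} (hρ : 0 < ρ) : gallagerKernel ρ 1 = (2:ℝ) ^ (-ρ) := by
  have h := gallagerKernel_one_sub_two_mul hρ le_rfl zero_le_one
  rw [zero_rpow (by positivity)] at h
  simpa using h

lemma half_rpow_add_half_rpow_eq {ρ p q : ℝ} (hρ : 0 < ρ) (hp : 0 ≤ p) (hq : 0 ≤ q) :
    ((1/2) * p ^ (1/(1+ρ)) + (1/2) * q ^ (1/(1+ρ))) ^ (1+ρ)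
      = (p + q) / 2 * gallagerKernel ρ (|p - q| / (p + q)) := by
  wlog hqp : q ≤ p generalizing p q
  · rw [add_comm p q, abs_sub_comm, ← this hq hp (le_of_not_ge hqp), add_comm]
  rcases (add_nonneg hp hq).eq_or_lt with h0 | h0
  · obtain rfl : p = 0 := by linarith
    obtain rfl : q = 0 := by linarith
    have h1 : 1 + ρ ≠ 0 := by positivity
    simp [zero_rpow, h1]
  · rw [abs_of_nonneg (sub_nonneg.2 hqp), gallagerKernel,
      show 1 + (p - q) / (p + q) = p / ((p + q) / 2) by field_simp; ring,
      show 1 - (p - q) / (p + q) = q / ((p + q) / 2) by field_simp; ring]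
    have hm : 0 < (p + q) / 2 := by linarith
    generalize (p + q) / 2 = m at hm
    rw [div_rpow hp hm.le, div_rpow hq hm.le, ← mul_div_assoc, ← mul_div_assoc, ← add_div,
      div_rpow (by positivity) (by positivity), ← rpow_mul hm.le,
      one_div_mul_cancel (by linarith), rpow_one]
    field_simp

namespace BDMC

/-- The output distribution of `W` under uniform input. -/
noncomputable def outputProb (W : BDMC) (y : W.Y) : ℝ := (W.W0 y + W.W1 y) / 2

/-- The bias of the binary symmetric channel that `W` reduces to, given the output `y`. -/
noncomputable def bias (W : BDMC) (y : W.Y) : ℝ := |W.W0 y - W.W1 y| / (W.W0 y + W.W1 y)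

lemma outputProb_nonneg (W : BDMC) (y : W.Y) : 0 ≤ W.outputProb y :=
  div_nonneg (add_nonneg (W.W0_nonneg y) (W.W1_nonneg y)) zero_le_two

lemma sum_outputProb (W : BDMC) : ∑ y, W.outputProb y = 1 := by
  simp only [outputProb]
  rw [← Finset.sum_div, Finset.sum_add_distrib, W.sum_W0, W.sum_W1]
  norm_num

lemma bias_mem (W : BDMC) (y : W.Y) : W.bias y ∈ Icc (0:ℝ) 1 := by
  have h0 := W.W0_nonneg y
  have h1 := W.W1_nonneg y
  refine ⟨div_nonneg (abs_nonneg _) (add_nonneg h0 h1), div_le_one_of_le₀ ?_ (add_nonneg h0 h1)⟩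
  exact abs_le.2 ⟨by linarith, by linarith⟩

end BDMC

lemma E0_eq_neg_log_sum_gallagerKernel {ρ : ℝ} (hρ : 0 < ρ) (W : BDMC) :
    E0 ρ W = -log (∑ y, W.outputProb y * gallagerKernel ρ (W.bias y)) := by
  rw [E0]
  congr 2
  exact Finset.sum_congr rfl fun y _ =>
    half_rpow_add_half_rpow_eq hρ (W.W0_nonneg y) (W.W1_nonneg y)

lemma gallagerKernel_mem {ρ z : ℝ} (hρ : 0 < ρ) (hz : z ∈ Icc (0:ℝ) 1) :
    gallagerKernel ρ z ∈ Icc (gallagerKernel ρ 1) (gallagerKernel ρ 0) :=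
  ⟨(strictAntiOn_gallagerKernel hρ).antitoneOn hz ⟨zero_le_one, le_rfl⟩ hz.2,
    (strictAntiOn_gallagerKernel hρ).antitoneOn ⟨le_rfl, zero_le_one⟩ hz hz.1⟩

lemma gallagerKernel_pos {ρ z : ℝ} (hρ : 0 < ρ) (hz : z ∈ Icc (0:ℝ) 1) :
    0 < gallagerKernel ρ z := by
  have h := (gallagerKernel_mem hρ hz).1
  rw [gallagerKernel_one hρ] at h
  exact (rpow_pos_of_pos two_pos _).trans_le h

lemma sum_gallagerKernel_mem {ρ : ℝ} (hρ : 0 < ρ) (W : BDMC) :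
    ∑ y, W.outputProb y * gallagerKernel ρ (W.bias y) ∈
      Icc (gallagerKernel ρ 1) (gallagerKernel ρ 0) := by
  simpa using (convex_Icc (gallagerKernel ρ 1) (gallagerKernel ρ 0)).sum_mem
    (fun y _ => W.outputProb_nonneg y) W.sum_outputProb
    (fun y _ => gallagerKernel_mem hρ (W.bias_mem y))

/-- Theorem 1, Part 3, case (g)–(g′): if `ρ₁ ∈ (0,1]` and
`E₀(ρ₁, BSC_x) ≤ E₀(ρ₁, W) ≤ E₀(ρ₁, BEC_ε)`, then for every `ρ₂ ≥ ρ₁`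
one has `E₀(ρ₂, BSC_x) ≤ E₀(ρ₂, W) ≤ E₀(ρ₂, BEC_ε)`. -/
theorem extremality_part3_g (W : BDMC) (ε x ρ₁ : ℝ)
    (hε : ε ∈ Set.Icc (0:ℝ) 1) (hx : x ∈ Set.Icc (0:ℝ) (1/2))
    (hρ₁ : ρ₁ ∈ Set.Ioc (0:ℝ) 1)
    (hBSC : E0bsc ρ₁ x ≤ E0 ρ₁ W) (hBEC : E0 ρ₁ W ≤ E0bec ρ₁ ε) :
    ∀ ρ₂ : ℝ, ρ₁ ≤ ρ₂ → E0bsc ρ₂ x ≤ E0 ρ₂ W ∧ E0 ρ₂ W ≤ E0bec ρ₂ ε := by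
  intro ρ₂ h
  have h0 : 0 < ρ₁ := hρ₁.1
  have h2 : 0 < ρ₂ := h0.trans_le h
  obtain ⟨F, hconc, hmono, hF⟩ := exists_concaveOn_gallagerKernel h0 hρ₁.2 h
  have hx' : 1 - 2 * x ∈ Icc (0:ℝ) 1 := ⟨by linarith [hx.2], by linarith [hx.1]⟩
  have hx1 : x ≤ 1 := by linarith [hx.2]
  have hε' : 0 ≤ 1 - ε := sub_nonneg.2 hε.2
  have sum_pos : ∀ {ρ : ℝ}, 0 < ρ → 0 < ∑ y, W.outputProb y * gallagerKernel ρ (W.bias y) :=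
    fun hρ => (gallagerKernel_pos hρ ⟨zero_le_one, le_rfl⟩).trans_le (sum_gallagerKernel_mem hρ W).1
  have one_mem : gallagerKernel ρ₁ 1 ∈ Icc (gallagerKernel ρ₁ 1) (gallagerKernel ρ₁ 0) :=
    gallagerKernel_mem h0 ⟨zero_le_one, le_rfl⟩
  have zero_mem : gallagerKernel ρ₁ 0 ∈ Icc (gallagerKernel ρ₁ 1) (gallagerKernel ρ₁ 0) :=
    gallagerKernel_mem h0 ⟨le_rfl, zero_le_one⟩
  have bec_pos : ∀ ρ : ℝ, 0 < (2:ℝ) ^ (-ρ) * (1 - ε) + ε := fun ρ => by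
    have h2ρ : (0:ℝ) < 2 ^ (-ρ) := rpow_pos_of_pos two_pos _
    rcases hε'.eq_or_lt with h | h
    · rw [← h]; linarith
    · linarith [mul_pos h2ρ h, hε.1]
  rw [E0_eq_neg_log_sum_gallagerKernel h0, E0bsc, ← gallagerKernel_one_sub_two_mul h0 hx.1 hx1,
    neg_le_neg_iff, log_le_log_iff (sum_pos h0) (gallagerKernel_pos h0 hx')] at hBSC
  rw [E0_eq_neg_log_sum_gallagerKernel h0, E0bec, neg_le_neg_iff,
    log_le_log_iff (bec_pos _) (sum_pos h0), ← gallagerKernel_one h0] at hBEC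
  rw [E0_eq_neg_log_sum_gallagerKernel h2, E0bsc, ← gallagerKernel_one_sub_two_mul h2 hx.1 hx1,
    E0bec, neg_le_neg_iff, neg_le_neg_iff, log_le_log_iff (sum_pos h2) (gallagerKernel_pos h2 hx'),
    log_le_log_iff (bec_pos _) (sum_pos h2), ← gallagerKernel_one h2]
  constructor
  · have jensen := hconc.le_map_sum (fun y _ => W.outputProb_nonneg y) W.sum_outputProb
      (fun y _ => gallagerKernel_mem h0 (W.bias_mem y))
    simp only [smul_eq_mul, hF _ (W.bias_mem _)] at jensen
    exact jensen.trans ((hmono (sum_gallagerKernel_mem h0 W) (gallagerKernel_mem h0 hx')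
      hBSC).trans_eq (hF _ hx'))
  · have hlt : gallagerKernel ρ₁ 1 < gallagerKernel ρ₁ 0 :=
      strictAntiOn_gallagerKernel h0 ⟨le_rfl, zero_le_one⟩ ⟨zero_le_one, le_rfl⟩ one_pos
    have hle : gallagerKernel ρ₂ 1 ≤ gallagerKernel ρ₂ 0 :=
      (gallagerKernel_mem h2 ⟨zero_le_one, le_rfl⟩).2
    set A := gallagerKernel ρ₁ 1
    set A' := gallagerKernel ρ₂ 1
    rw [gallagerKernel_zero] at hlt hle
    have hA : 0 < 1 - A := sub_pos.2 hlt
    have chord : ∀ y, A' + (1 - A') / (1 - A) * (gallagerKernel ρ₁ (W.bias y) - A)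
        ≤ gallagerKernel ρ₂ (W.bias y) := fun y => by
      have hy := gallagerKernel_mem h0 (W.bias_mem y)
      rw [gallagerKernel_zero] at hy
      have hc := hconc.2 one_mem zero_mem (div_nonneg (sub_nonneg.2 hy.2) hA.le)
        (div_nonneg (sub_nonneg.2 hy.1) hA.le) (by field_simp; ring)
      rw [hF 1 ⟨zero_le_one, le_rfl⟩, hF 0 ⟨le_rfl, zero_le_one⟩, gallagerKernel_zero,
        gallagerKernel_zero] at hc
      simp only [smul_eq_mul] at hc
      rw [← hF _ (W.bias_mem y)]
      refine (le_of_eq ?_).trans (hc.trans_eq (congrArg F ?_))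
      · change _ = _ * A' + _
        field_simp; ring
      · change _ * A + _ = _
        field_simp; ring
    calc A' * (1 - ε) + ε = A' + (1 - A') / (1 - A) * ((A * (1 - ε) + ε) - A) := by
          field_simp; ring
      _ ≤ A' + (1 - A') / (1 - A)
            * (∑ y, W.outputProb y * gallagerKernel ρ₁ (W.bias y) - A) := by
          have := div_nonneg (sub_nonneg.2 hle) hA.le
          gcongr
      _ = ∑ y, W.outputProb y *
            (A' + (1 - A') / (1 - A) * (gallagerKernel ρ₁ (W.bias y) - A)) := by
          have e : ∀ y, W.outputProb y *
              (A' + (1 - A') / (1 - A) * (gallagerKernel ρ₁ (W.bias y) - A))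
              = (A' - (1 - A') / (1 - A) * A) * W.outputProb y
                + (1 - A') / (1 - A) * (W.outputProb y * gallagerKernel ρ₁ (W.bias y)) :=
            fun y => by ring
          rw [Finset.sum_congr rfl fun y _ => e y, Finset.sum_add_distrib, ← Finset.mul_sum,
            ← Finset.mul_sum, W.sum_outputProb]
          ring
      _ ≤ _ := Finset.sum_le_sum fun y _ =>
          mul_le_mul_of_nonneg_left (chord y) (W.outputProb_nonneg y)
end
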